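/- Suppose 1/δ < γ̃* < +∞ and there exists c* ∈ (0,1) with ζ̃(c*) = γ̃*. Then G*(z) := k*·1_{z ≥ c*} on (0,1), where k* := x / ∫_{c*}^1 φ(z) dz, is a φ-feasible quantile function whose objective value equals γ̃*·x, and its objective value is greater than or equal to that of every φ-feasible quantile function; i.e., it is optimal. -/

import Mathlib

open MeasureTheory Set Filter Topology ENNReal

noncomputable section

/-- A φ-feasible quantile function for weight function `φ` and initial wealth `x`:
nondecreasing and right-continuous on `(0,1)`, with `lim_{z↓0} G(z) ≥ 0`, satisfying the
budget constraint `∫_0^1 φ(z) G(z) dz ≤ x`. -/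
def FeasibleW (φ : ℝ → ℝ) (x : ℝ) (G : ℝ → ℝ) : Prop :=
  MonotoneOn G (Set.Ioo 0 1)
  ∧ (∀ z ∈ Set.Ioo (0:ℝ) 1, Filter.Tendsto G (nhdsWithin z (Set.Ioi z)) (nhds (G z)))
  ∧ (∃ L, 0 ≤ L ∧ Filter.Tendsto G (nhdsWithin 0 (Set.Ioi 0)) (nhds L))
  ∧ ∫⁻ z in Set.Ioo (0:ℝ) 1, ENNReal.ofReal (φ z * G z) ≤ ENNReal.ofReal x

/-- The extension `Ḡ` of a (nonnegative) quantile function `G` from `(0,1)` to `[0,1]`,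
valued in `[0,∞]`, with `Ḡ(0) = lim_{z↓0} G(z)` and `Ḡ(1) = lim_{z↑1} G(z)`
(these limits are the inf/sup over `(0,1)` since `G` is nondecreasing). -/
def Gbar (G : ℝ → ℝ) : ℝ → ℝ≥0∞ := fun z =>
  if z = 0 then ⨅ y ∈ Set.Ioo (0:ℝ) 1, ENNReal.ofReal (G y)
  else if z = 1 then ⨆ y ∈ Set.Ioo (0:ℝ) 1, ENNReal.ofReal (G y)
  else ENNReal.ofReal (G z)

/-- The objective value `∫_{[0,1]} Ḡ(z) m(dz)` of a quantile function `G`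
(for `m` a Borel probability measure carried by `[0,1]`). -/
def objVal (m : Measure ℝ) (G : ℝ → ℝ) : ℝ≥0∞ := ∫⁻ z, Gbar G z ∂m

/-- `ζ̃(c) = m([c,1]) / ∫_c^1 φ(z) dz`. -/
def zetaW (φ : ℝ → ℝ) (m : Measure ℝ) (c : ℝ) : ℝ :=
  (m (Set.Icc c 1)).toReal / ∫ z in c..1, φ z

/-- Layer cake formula for a function truncated at level `n`. -/
theorem lintegral_min_natCast_eq_lintegral_meas_lt {α : Type*} [MeasurableSpace α]
    (μ : Measure α) {f : α → ℝ≥0∞} (hf : AEMeasurable f μ) (n : ℕ) :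
    ∫⁻ a, min (f a) n ∂μ
      = ∫⁻ t in Ioi (0 : ℝ), μ {a | ENNReal.ofReal t < f a ∧ ENNReal.ofReal t < n} := by
  have hfin : ∀ a, min (f a) (n : ℝ≥0∞) ≠ ∞ := fun a =>
    ((min_le_right _ _).trans_lt (ENNReal.natCast_lt_top n)).ne
  have key := lintegral_eq_lintegral_meas_lt μ (f := fun a => (min (f a) (n : ℝ≥0∞)).toReal)
    (Eventually.of_forall fun a => ENNReal.toReal_nonneg)
    (hf.min aemeasurable_const).ennreal_toReal
  simp only [ENNReal.ofReal_toReal (hfin _)] at key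
  rw [key]
  refine setLIntegral_congr_fun measurableSet_Ioi fun t ht => ?_
  congr 1
  ext a
  simp only [mem_ofPred_eq]
  rw [← ENNReal.ofReal_lt_iff_lt_toReal (le_of_lt ht) (hfin a), lt_min_iff]

/-- Comparison of superlevel sets implies comparison of lower Lebesgue integrals. -/
theorem lintegral_le_lintegral_of_meas_lt_le {α β : Type*} [MeasurableSpace α] [MeasurableSpace β]
    {μ : Measure α} {ν : Measure β} {f : α → ℝ≥0∞} {g : β → ℝ≥0∞}
    (hf : AEMeasurable f μ) (hg : AEMeasurable g ν)
    (h : ∀ t : ℝ, 0 < t → μ {a | ENNReal.ofReal t < f a} ≤ ν {b | ENNReal.ofReal t < g b}) :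
    ∫⁻ a, f a ∂μ ≤ ∫⁻ b, g b ∂ν := by
  have hsup : ∀ a, f a = ⨆ n : ℕ, min (f a) (n : ℝ≥0∞) := fun a => by
    have := (inf_iSup_eq (f a) (fun n : ℕ => (n : ℝ≥0∞))).symm
    rw [ENNReal.iSup_natCast, inf_top_eq] at this
    exact this.symm
  have hmono : ∀ a, Monotone fun n : ℕ => min (f a) (n : ℝ≥0∞) := fun a i j hij =>
    min_le_min le_rfl (by exact_mod_cast hij)
  calc ∫⁻ a, f a ∂μ = ∫⁻ a, ⨆ n : ℕ, min (f a) (n : ℝ≥0∞) ∂μ := lintegral_congr hsup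
    _ = ⨆ n : ℕ, ∫⁻ a, min (f a) (n : ℝ≥0∞) ∂μ :=
        lintegral_iSup' (fun n => hf.min aemeasurable_const) (Eventually.of_forall hmono)
    _ ≤ ∫⁻ b, g b ∂ν := iSup_le fun n => by
        refine le_trans ?_ (lintegral_mono fun b => min_le_left (g b) (n : ℝ≥0∞))
        rw [lintegral_min_natCast_eq_lintegral_meas_lt μ hf,
          lintegral_min_natCast_eq_lintegral_meas_lt ν hg]
        refine setLIntegral_mono' measurableSet_Ioi fun t ht => ?_
        by_cases hn : ENNReal.ofReal t < n
        · simpa only [hn, and_true] using h t ht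
        · simp [hn]

/-- An interval integral of a positive weight up to `1`, as a lower Lebesgue integral. -/
theorem setLIntegral_Ioo_ofReal_eq {φ : ℝ → ℝ} (hφpos : ∀ z ∈ Ioo (0 : ℝ) 1, 0 < φ z)
    (hφint : IntegrableOn φ (Ioo 0 1)) {c : ℝ} (hc : c ∈ Ico (0 : ℝ) 1) :
    ∫⁻ z in Ioo c 1, ENNReal.ofReal (φ z) = ENNReal.ofReal (∫ z in c..1, φ z) := by
  have hsub : Ioo c 1 ⊆ Ioo 0 1 := Ioo_subset_Ioo_left hc.1
  rw [intervalIntegral.integral_of_le hc.2.le, integral_Ioc_eq_integral_Ioo,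
    ofReal_integral_eq_lintegral_ofReal (hφint.mono_set hsub)]
  exact (ae_restrict_iff' measurableSet_Ioo).2
    (Eventually.of_forall fun z hz => (hφpos z (hsub hz)).le)

theorem integral_weight_pos {φ : ℝ → ℝ} (hφpos : ∀ z ∈ Ioo (0 : ℝ) 1, 0 < φ z)
    (hφint : IntegrableOn φ (Ioo 0 1)) {c : ℝ} (hc : c ∈ Ico (0 : ℝ) 1) :
    0 < ∫ z in c..1, φ z := by
  have hsub : Ioo c 1 ⊆ Ioo 0 1 := Ioo_subset_Ioo_left hc.1
  exact intervalIntegral.intervalIntegral_pos_of_pos_on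
    ((intervalIntegrable_iff_integrableOn_Ioo_of_le hc.2.le).2 (hφint.mono_set hsub))
    (fun z hz => hφpos z (hsub hz)) hc.2

theorem Gbar_of_mem_Ioo {G : ℝ → ℝ} {z : ℝ} (hz : z ∈ Ioo (0 : ℝ) 1) :
    Gbar G z = ENNReal.ofReal (G z) := by
  simp [Gbar, hz.1.ne', hz.2.ne]

theorem Gbar_zero (G : ℝ → ℝ) : Gbar G 0 = ⨅ y ∈ Ioo (0 : ℝ) 1, ENNReal.ofReal (G y) := by
  simp [Gbar]

theorem Gbar_one (G : ℝ → ℝ) : Gbar G 1 = ⨆ y ∈ Ioo (0 : ℝ) 1, ENNReal.ofReal (G y) := by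
  simp [Gbar]

theorem Gbar_monotoneOn {G : ℝ → ℝ} (hG : MonotoneOn G (Ioo 0 1)) :
    MonotoneOn (Gbar G) (Icc 0 1) := by
  intro a ha b hb hab
  have h0 : ∀ y ∈ Ioo (0 : ℝ) 1, Gbar G 0 ≤ ENNReal.ofReal (G y) := fun y hy => by
    rw [Gbar_zero]; exact iInf₂_le y hy
  have h1 : ∀ y ∈ Ioo (0 : ℝ) 1, ENNReal.ofReal (G y) ≤ Gbar G 1 := fun y hy => by
    rw [Gbar_one]; exact le_iSup₂ (f := fun y (_ : y ∈ Ioo (0 : ℝ) 1) => ENNReal.ofReal (G y)) y hy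
  have hhalf : (1 / 2 : ℝ) ∈ Ioo (0 : ℝ) 1 := by norm_num
  rcases eq_endpoints_or_mem_Ioo_of_mem_Icc ha with rfl | rfl | ha'
  · rcases eq_endpoints_or_mem_Ioo_of_mem_Icc hb with rfl | rfl | hb'
    · exact le_rfl
    · exact (h0 _ hhalf).trans (h1 _ hhalf)
    · rw [Gbar_of_mem_Ioo hb']; exact h0 _ hb'
  · rw [le_antisymm hb.2 hab]
  · rcases eq_endpoints_or_mem_Ioo_of_mem_Icc hb with rfl | rfl | hb'
    · exact absurd ha'.1 hab.not_gt
    · rw [Gbar_of_mem_Ioo ha']; exact h1 _ ha'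
    · rw [Gbar_of_mem_Ioo ha', Gbar_of_mem_Ioo hb']
      exact ENNReal.ofReal_le_ofReal (hG ha' hb' hab)

/-- If a measure of each `[c, 1]`, with `c` in an upper subset `S` of `(0, 1)`, is at most `B`,
then so is the measure of `S ∪ {1}`. -/
theorem measure_union_one_le (m : Measure ℝ) {S : Set ℝ} (hS : S ⊆ Ioo 0 1) (hne : S.Nonempty)
    {B : ℝ≥0∞} (hB : ∀ c ∈ S, m (Icc c 1) ≤ B) : m (S ∪ {1}) ≤ B := by
  have hbdd : BddBelow S := ⟨0, fun z hz => (hS hz).1.le⟩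
  by_cases hmin : sInf S ∈ S
  · refine (measure_mono ?_).trans (hB _ hmin)
    rintro z (hz | rfl)
    · exact ⟨csInf_le hbdd hz, (hS hz).2.le⟩
    · exact ⟨(hS hmin).2.le, le_rfl⟩
  · obtain ⟨u, hu, hlim, huS⟩ := exists_seq_tendsto_sInf hne hbdd
    have hmono : Monotone fun n => Icc (u n) (1 : ℝ) := fun i j hij => Icc_subset_Icc_left (hu hij)
    have hsub : S ∪ {1} ⊆ ⋃ n, Icc (u n) 1 := by
      rintro z (hz | rfl)
      · have hlt : sInf S < z :=
          lt_of_le_of_ne (csInf_le hbdd hz) fun h => hmin (h ▸ hz)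
        obtain ⟨n, hn⟩ := (hlim.eventually (gt_mem_nhds hlt)).exists
        exact mem_iUnion.2 ⟨n, hn.le, (hS hz).2.le⟩
      · exact mem_iUnion.2 ⟨0, (hS (huS 0)).2.le, le_rfl⟩
    refine (measure_mono hsub).trans ?_
    rw [hmono.measure_iUnion]
    exact iSup_le fun n => hB _ (huS n)

/-- If `γ` bounds `m [c, 1] / ∫_c^1 φ` on `(0, 1)` and `1 ≤ γ * ∫_0^1 φ`, then every monotone
`G` on `(0, 1)` has objective value at most `γ` times its cost. -/
theorem objVal_le_mul_cost {φ : ℝ → ℝ} (hφmeas : Measurable φ)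
    (hφpos : ∀ z ∈ Ioo (0 : ℝ) 1, 0 < φ z) (hφint : IntegrableOn φ (Ioo 0 1))
    (m : Measure ℝ) [IsProbabilityMeasure m] (hm : m (Icc (0 : ℝ) 1)ᶜ = 0) {γ : ℝ} (hγ : 0 ≤ γ)
    (hzeta : ∀ c ∈ Ioo (0 : ℝ) 1, zetaW φ m c ≤ γ) (hone : 1 ≤ γ * ∫ z in (0 : ℝ)..1, φ z)
    {G : ℝ → ℝ} (hG : MonotoneOn G (Ioo 0 1)) :
    objVal m G ≤ ENNReal.ofReal γ * ∫⁻ z in Ioo (0 : ℝ) 1, ENNReal.ofReal (φ z * G z) := by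
  set ν : Measure ℝ :=
    (volume.restrict (Ioo (0 : ℝ) 1)).withDensity (fun z => ENNReal.ofReal (φ z)) with hν
  have hφm : Measurable fun z => ENNReal.ofReal (φ z) := hφmeas.ennreal_ofReal
  have hGm : AEMeasurable (fun z => ENNReal.ofReal (G z)) (volume.restrict (Ioo (0 : ℝ) 1)) :=
    (aemeasurable_restrict_of_monotoneOn measurableSet_Ioo hG).ennreal_ofReal
  have hcost : ∫⁻ z, ENNReal.ofReal (G z) ∂(ENNReal.ofReal γ • ν)
      = ENNReal.ofReal γ * ∫⁻ z in Ioo (0 : ℝ) 1, ENNReal.ofReal (φ z * G z) := by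
    rw [lintegral_smul_measure, smul_eq_mul, hν,
      lintegral_withDensity_eq_lintegral_mul₀ hφm.aemeasurable hGm]
    congr 1
    refine setLIntegral_congr_fun measurableSet_Ioo fun z hz => ?_
    simp only [Pi.mul_apply]
    rw [ENNReal.ofReal_mul (hφpos z hz).le]
  have hνIoo : ∀ c ∈ Ico (0 : ℝ) 1,
      ν (Ioo c 1) = ENNReal.ofReal (∫ z in c..1, φ z) := fun c hc => by
    rw [hν, withDensity_apply _ measurableSet_Ioo, Measure.restrict_restrict measurableSet_Ioo,
      inter_eq_left.2 (Ioo_subset_Ioo_left hc.1), setLIntegral_Ioo_ofReal_eq hφpos hφint hc]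
  have hmres : m.restrict (Icc 0 1) = m :=
    Measure.restrict_eq_self_of_ae_mem (mem_ae_iff.2 hm)
  have hbar : AEMeasurable (Gbar G) m := by
    have := aemeasurable_restrict_of_monotoneOn (μ := m) measurableSet_Icc (Gbar_monotoneOn hG)
    rwa [hmres] at this
  rw [← hcost, objVal]
  refine lintegral_le_lintegral_of_meas_lt_le hbar ?_ fun t _ => ?_
  · exact (hGm.mono_ac (withDensity_absolutelyContinuous _ _)).smul_measure _
  rw [Measure.smul_apply, smul_eq_mul]
  set S : Set ℝ := {z | z ∈ Ioo (0 : ℝ) 1 ∧ ENNReal.ofReal t < ENNReal.ofReal (G z)} with hSdef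
  have hSsub : S ⊆ {z | ENNReal.ofReal t < ENNReal.ofReal (G z)} := fun z hz => hz.2
  refine le_trans ?_ (mul_le_mul_right (measure_mono hSsub) _)
  rcases S.eq_empty_or_nonempty with hempty | hne
  · have hle : ∀ y ∈ Ioo (0 : ℝ) 1, ENNReal.ofReal (G y) ≤ ENNReal.ofReal t := fun y hy =>
      not_lt.1 fun h => (hempty ▸ (⟨hy, h⟩ : y ∈ S) : y ∈ (∅ : Set ℝ))
    refine le_of_eq_of_le ?_ zero_le
    refine measure_mono_null (t := (Icc (0 : ℝ) 1)ᶜ) ?_ hm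
    intro z hz hz01
    have h1 : Gbar G 1 ≤ ENNReal.ofReal t := by rw [Gbar_one]; exact iSup₂_le hle
    exact absurd ((Gbar_monotoneOn hG hz01 (right_mem_Icc.2 zero_le_one) hz01.2).trans h1)
      (not_le.2 hz)
  · by_cases hall : Ioo 0 1 ⊆ S
    · calc m {z | ENNReal.ofReal t < Gbar G z} ≤ 1 := prob_le_one
        _ ≤ ENNReal.ofReal (γ * ∫ z in (0 : ℝ)..1, φ z) := ENNReal.one_le_ofReal.2 hone
        _ = ENNReal.ofReal γ * ν (Ioo 0 1) := by
          rw [hνIoo 0 ⟨le_rfl, one_pos⟩, ENNReal.ofReal_mul hγ]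
        _ ≤ ENNReal.ofReal γ * ν S := by gcongr
    · obtain ⟨y, hy, hyS⟩ := not_subset.1 hall
      have hy' : ENNReal.ofReal (G y) ≤ ENNReal.ofReal t := not_lt.1 fun h => hyS ⟨hy, h⟩
      have hsub : {z | ENNReal.ofReal t < Gbar G z} ⊆ (S ∪ {1}) ∪ (Icc (0 : ℝ) 1)ᶜ := by
        intro z hz
        by_cases hz01 : z ∈ Icc (0 : ℝ) 1
        · left
          rcases eq_endpoints_or_mem_Ioo_of_mem_Icc hz01 with rfl | rfl | hz'
          · refine absurd (lt_of_lt_of_le hz ?_) (not_lt.2 hy')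
            rw [Gbar_zero]
            exact iInf₂_le y hy
          · exact Or.inr rfl
          · exact Or.inl ⟨hz', Gbar_of_mem_Ioo (G := G) hz' ▸ hz⟩
        · exact Or.inr hz01
      refine (measure_mono hsub).trans ((measure_union_le _ _).trans ?_)
      rw [hm, add_zero]
      refine measure_union_one_le m (fun z hz => hz.1) hne fun c hcS => ?_
      have hc := hcS.1
      have hc' : c ∈ Ico (0 : ℝ) 1 := ⟨hc.1.le, hc.2⟩
      have hle := (div_le_iff₀ (integral_weight_pos hφpos hφint hc')).1 (hzeta c hc)
      calc m (Icc c 1) ≤ ENNReal.ofReal (γ * ∫ z in c..1, φ z) :=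
            (ENNReal.le_ofReal_iff_toReal_le (measure_ne_top _ _)
              (ENNReal.toReal_nonneg.trans hle)).2 hle
        _ = ENNReal.ofReal γ * ν (Ioo c 1) := by rw [hνIoo c hc', ENNReal.ofReal_mul hγ]
        _ ≤ ENNReal.ofReal γ * ν S := by
          gcongr
          intro z hz
          have hz' : z ∈ Ioo (0 : ℝ) 1 := ⟨hc.1.trans hz.1, hz.2⟩
          exact ⟨hz', hcS.2.trans_le (ENNReal.ofReal_le_ofReal (hG hc hz' hz.1.le))⟩

/-- The digital quantile function with threshold `c` and height `k`. -/
theorem objVal_digital (m : Measure ℝ) (hm : m (Icc (0 : ℝ) 1)ᶜ = 0) {c k : ℝ}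
    (hc : c ∈ Ioo (0 : ℝ) 1) :
    objVal m (fun z => if c ≤ z then k else 0) = ENNReal.ofReal k * m (Icc c 1) := by
  rw [objVal, ← lintegral_indicator_const measurableSet_Icc]
  refine lintegral_congr_ae ?_
  filter_upwards [mem_ae_iff.2 hm] with z hz
  rcases eq_endpoints_or_mem_Ioo_of_mem_Icc hz with rfl | rfl | hz'
  · rw [Gbar_zero, indicator_of_notMem fun h => hc.1.not_ge h.1, ← nonpos_iff_eq_zero]
    refine (iInf₂_le (c / 2) ⟨by linarith [hc.1], by linarith [hc.2]⟩).trans ?_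
    rw [if_neg (by linarith [hc.1]), ENNReal.ofReal_zero]
  · rw [Gbar_one, indicator_of_mem (show (1 : ℝ) ∈ Icc c 1 from ⟨hc.2.le, le_rfl⟩)]
    refine le_antisymm (iSup₂_le fun y _ => ?_) ?_
    · split_ifs <;> simp
    · refine le_of_eq_of_le ?_ (le_iSup₂ (f := fun y (_ : y ∈ Ioo (0 : ℝ) 1) =>
        ENNReal.ofReal (if c ≤ y then k else 0)) c hc)
      simp
  · rw [Gbar_of_mem_Ioo hz']
    by_cases h : c ≤ z
    · simp [h, hz'.2.le]
    · simp [h]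

theorem feasibleW_digital {φ : ℝ → ℝ} (hφpos : ∀ z ∈ Ioo (0 : ℝ) 1, 0 < φ z)
    (hφint : IntegrableOn φ (Ioo 0 1)) {x : ℝ} (hx : 0 < x) {c : ℝ} (hc : c ∈ Ioo (0 : ℝ) 1) :
    FeasibleW φ x (fun z => if c ≤ z then x / ∫ t in c..1, φ t else 0) := by
  have hc' : c ∈ Ico (0 : ℝ) 1 := ⟨hc.1.le, hc.2⟩
  have hI := integral_weight_pos hφpos hφint hc'
  have hk : 0 < x / ∫ t in c..1, φ t := div_pos hx hI
  refine ⟨fun a _ b _ hab => ?_, fun z _ => ?_, ⟨0, le_rfl, ?_⟩, ?_⟩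
  · by_cases ha : c ≤ a
    · simp [ha, ha.trans hab]
    · simp only [ha, if_false]
      split_ifs
      exacts [hk.le, le_rfl]
  · refine tendsto_const_nhds.congr' ?_
    by_cases h : c ≤ z
    · filter_upwards [self_mem_nhdsWithin] with y hy
      simp [h, h.trans (le_of_lt hy)]
    · filter_upwards [mem_nhdsWithin_of_mem_nhds (gt_mem_nhds (not_le.1 h))] with y hy
      simp [h, not_le.2 hy]
  · refine tendsto_const_nhds.congr' ?_
    filter_upwards [mem_nhdsWithin_of_mem_nhds (gt_mem_nhds hc.1)] with y hy
    simp [not_le.2 hy]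
  · have hpt : ∀ z ∈ Ioo (0 : ℝ) 1,
        ENNReal.ofReal (φ z * if c ≤ z then x / ∫ t in c..1, φ t else 0)
          = (Ici c).indicator
            (fun z => ENNReal.ofReal (x / ∫ t in c..1, φ t) * ENNReal.ofReal (φ z)) z := by
      intro z hz
      by_cases h : c ≤ z
      · simp only [h, if_true, indicator_of_mem (mem_Ici.2 h)]
        rw [mul_comm, ENNReal.ofReal_mul hk.le]
      · simp [h]
    have hset : Ici c ∩ Ioo 0 1 = Ico c 1 := by
      ext z
      exact ⟨fun h => ⟨h.1, h.2.2⟩, fun h => ⟨h.1, hc.1.trans_le h.1, h.2⟩⟩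
    rw [setLIntegral_congr_fun measurableSet_Ioo hpt, lintegral_indicator measurableSet_Ici,
      Measure.restrict_restrict measurableSet_Ici, hset,
      lintegral_const_mul' _ _ ENNReal.ofReal_ne_top, ← setLIntegral_congr Ioo_ae_eq_Ico,
      setLIntegral_Ioo_ofReal_eq hφpos hφint hc', ← ENNReal.ofReal_mul hk.le,
      div_mul_cancel₀ _ hI.ne']

/-- if `1/δ < γ̃* < +∞` and the supremum of `ζ̃` is attained at
`c* ∈ (0,1)`, then `G*(z) = k*·1_{z ≥ c*}` with `k* = x / ∫_{c*}^1 φ(z) dz` is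
φ-feasible, has objective value `γ̃*·x = ζ̃(c*)·x`, and is optimal. -/
theorem digital_optimal_of_attained_phi
    (φ : ℝ → ℝ) (hφmeas : Measurable φ) (hφpos : ∀ z ∈ Set.Ioo (0:ℝ) 1, 0 < φ z)
    (hφint : IntegrableOn φ (Set.Ioo 0 1))
    (δ : ℝ) (hδ : δ = ∫ z in (0:ℝ)..1, φ z) (hδpos : 0 < δ)
    (m : Measure ℝ) [IsProbabilityMeasure m] (hm : m (Set.Icc (0:ℝ) 1)ᶜ = 0)
    (x : ℝ) (hx : 0 < x)
    (cstar : ℝ) (hc : cstar ∈ Set.Ioo (0:ℝ) 1)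
    (hattain : ∀ c ∈ Set.Ioo (0:ℝ) 1, zetaW φ m c ≤ zetaW φ m cstar)
    (hgt : 1 / δ < zetaW φ m cstar) :
    FeasibleW φ x (fun z => if cstar ≤ z then x / ∫ t in cstar..1, φ t else 0)
    ∧ objVal m (fun z => if cstar ≤ z then x / ∫ t in cstar..1, φ t else 0)
        = ENNReal.ofReal (zetaW φ m cstar * x)
    ∧ ∀ G : ℝ → ℝ, FeasibleW φ x G →
        objVal m G ≤ objVal m (fun z => if cstar ≤ z then x / ∫ t in cstar..1, φ t else 0) := by
  have hI := integral_weight_pos hφpos hφint ⟨hc.1.le, hc.2⟩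
  have hγ : 0 ≤ zetaW φ m cstar := div_nonneg ENNReal.toReal_nonneg hI.le
  have hval : objVal m (fun z => if cstar ≤ z then x / ∫ t in cstar..1, φ t else 0)
      = ENNReal.ofReal (zetaW φ m cstar * x) := by
    rw [objVal_digital m hm hc, ← ENNReal.ofReal_toReal (measure_ne_top m (Icc cstar 1)),
      ← ENNReal.ofReal_mul (div_pos hx hI).le, zetaW, div_mul_comm]
  refine ⟨feasibleW_digital hφpos hφint hx hc, hval, fun G hG => ?_⟩
  have hone : 1 ≤ zetaW φ m cstar * ∫ z in (0 : ℝ)..1, φ z :=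
    hδ ▸ ((div_lt_iff₀ hδpos).1 hgt).le
  rw [hval, ENNReal.ofReal_mul hγ]
  refine (objVal_le_mul_cost hφmeas hφpos hφint m hm hγ hattain hone hG.1).trans ?_
  gcongr
  exact hG.2.2.2
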